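/- Let a < b be real numbers and n ≥ 1 a natural number. Let μ₁, μ₂ be finite signed measures on ℝ concentrated on (a,b], with distribution functions F₁(x) = μ₁((a,x]), F₂(x) = μ₂((a,x]). Define H₀ = F₂ − F₁ and H_k(x) = ∫_a^x H_{k−1}(t) dt for k = 1, …, n. Then ∫_{[a,b]} f dμ₁ ≤ ∫_{[a,b]} f dμ₂ for every continuous n-convex function f : [a,b] → ℝ if and only if H_k(b) = 0 for every k = 0, 1, …, n and (−1)^{n+1} H_n(x) ≥ 0 for every x ∈ (a,b). -/

import Mathlib

open MeasureTheory Set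

/-- Integral of `f` with respect to a finite signed measure `μ`,
defined via the Jordan decomposition `μ = μ⁺ - μ⁻`. -/
noncomputable def sintegral (μ : SignedMeasure ℝ) (f : ℝ → ℝ) : ℝ :=
  (∫ x, f x ∂μ.toJordanDecomposition.posPart) - ∫ x, f x ∂μ.toJordanDecomposition.negPart

/-- Integral of `f` over a set `s` with respect to a finite signed measure `μ`. -/
noncomputable def sintegralOn (μ : SignedMeasure ℝ) (s : Set ℝ) (f : ℝ → ℝ) : ℝ :=
  (∫ x in s, f x ∂μ.toJordanDecomposition.posPart) - ∫ x in s, f x ∂μ.toJordanDecomposition.negPart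

/-- A signed measure `μ` is concentrated on `s` if `|μ|(sᶜ) = 0`. -/
def ConcentratedOn (μ : SignedMeasure ℝ) (s : Set ℝ) : Prop :=
  μ.totalVariation sᶜ = 0

/-- Iterated integrals based at `a`: `I₀ = F`, `I_{k+1}(x) = ∫_a^x I_k(t) dt`. -/
noncomputable def iterInt (a : ℝ) (F : ℝ → ℝ) : ℕ → ℝ → ℝ
  | 0 => F
  | k + 1 => fun x => ∫ t in a..x, iterInt a F k t

/-- `f` is `n`-convex on `(a,b)` (`n ≥ 1`): it is `(n-1)`-times differentiable on `(a,b)`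
and its `(n-1)`-st derivative is convex on `(a,b)`. -/
def NConvexOn (n : ℕ) (a b : ℝ) (f : ℝ → ℝ) : Prop :=
  ContDiffOn ℝ ((n - 1 : ℕ) : ℕ∞) f (Ioo a b) ∧
  ConvexOn ℝ (Ioo a b) (iteratedDerivWithin (n - 1) f (Ioo a b))

theorem setIntegral_Ioc_eq_sub_integral_deriv (P : Measure ℝ) [IsFiniteMeasure P] {a t : ℝ}
    (hat : a ≤ t) {u : ℝ → ℝ} (hu : AbsolutelyContinuousOnInterval u a t) :
    ∫ s in Ioc a t, u s ∂P
      = u t * P.real (Ioc a t) - ∫ s in a..t, P.real (Ioc a s) * deriv u s := by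
  have hd : Integrable (deriv u) (volume.restrict (Ioc a t)) :=
    (intervalIntegrable_iff_integrableOn_Ioc_of_le hat).1 hu.intervalIntegrable_deriv
  have hrep : ∀ s ∈ Ioc a t,
      u s = u t - ∫ r in Ioc a t, (Ici s).indicator (deriv u) r := by
    intro s hs
    have h1 : AbsolutelyContinuousOnInterval u s t := hu.mono (by
      rw [uIcc_of_le hat, uIcc_of_le hs.2]; exact Icc_subset_Icc_left hs.1.le)
    have h2 := h1.integral_deriv_eq_sub
    rw [setIntegral_indicator measurableSet_Ici]
    have h3 : Ioc a t ∩ Ici s = Icc s t := by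
      ext r; simp only [mem_inter_iff, mem_Ioc, mem_Ici, mem_Icc]
      exact ⟨fun h => ⟨h.2, h.1.2⟩, fun h => ⟨⟨hs.1.trans_le h.1, h.2⟩, h.1⟩⟩
    rw [h3, integral_Icc_eq_integral_Ioc, ← intervalIntegral.integral_of_le hs.2, h2]
    ring
  have hint : Integrable (Function.uncurry fun s r : ℝ => (Ici s).indicator (deriv u) r)
      ((P.restrict (Ioc a t)).prod (volume.restrict (Ioc a t))) := by
    have h1 := (hd.comp_snd (P.restrict (Ioc a t))).indicator
      (measurableSet_le (measurable_fst : Measurable (Prod.fst : ℝ × ℝ → ℝ)) measurable_snd)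
    exact h1
  have hswap := integral_integral_swap hint
  have hleft : Integrable (fun s => ∫ r in Ioc a t, (Ici s).indicator (deriv u) r)
      (P.restrict (Ioc a t)) := hint.integral_prod_left
  rw [setIntegral_congr_fun measurableSet_Ioc hrep,
    integral_sub (integrable_const _) hleft, hswap, setIntegral_const,
    intervalIntegral.integral_of_le hat, smul_eq_mul, mul_comm]
  congr 1
  refine setIntegral_congr_fun measurableSet_Ioc fun r hr => ?_
  have h4 : (fun s : ℝ => (Ici s).indicator (deriv u) r)
      = (Iic r).indicator fun _ => deriv u r := by
    ext s; simp [indicator]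
  simp only [h4]
  rw [setIntegral_indicator measurableSet_Iic, setIntegral_const, smul_eq_mul, Ioc_inter_Iic,
    min_eq_right hr.2]

theorem integral_mul_eq_sub_integral_primitive_mul_deriv {a t : ℝ} {h u : ℝ → ℝ}
    (hh : IntervalIntegrable h volume a t) (hu : AbsolutelyContinuousOnInterval u a t) :
    ∫ s in a..t, h s * u s
      = (∫ s in a..t, h s) * u t - ∫ s in a..t, (∫ r in a..s, h r) * deriv u s := by
  have hK := hh.absolutelyContinuousOnInterval_intervalIntegral (c := a) left_mem_uIcc
  rw [hK.integral_mul_deriv_eq_deriv_mul hu, intervalIntegral.integral_same]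
  have : ∫ s in a..t, h s * u s = ∫ s in a..t, deriv (fun x => ∫ r in a..x, h r) s * u s := by
    refine intervalIntegral.integral_congr_ae ?_
    filter_upwards [hh.ae_hasDerivAt_integral] with x hx hxm
    rw [(hx (uIoc_subset_uIcc hxm) a left_mem_uIcc).deriv]
  rw [this]; ring

theorem intervalIntegrable_iterInt (a : ℝ) {F : ℝ → ℝ}
    (hF : ∀ c d, IntervalIntegrable F volume c d) (k : ℕ) (c d : ℝ) :
    IntervalIntegrable (iterInt a F k) volume c d := by
  induction k generalizing c d with
  | zero => exact hF c d
  | succ k ih => exact (intervalIntegral.continuous_primitive ih a).intervalIntegrable c d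

/-- The distribution function, based at `a`, of the difference `P - N` of two measures. -/
noncomputable def cdfDiff (P N : Measure ℝ) (a x : ℝ) : ℝ :=
  P.real (Ioc a x) - N.real (Ioc a x)

theorem intervalIntegrable_real_Ioc (P : Measure ℝ) [IsFiniteMeasure P] (a c d : ℝ) :
    IntervalIntegrable (fun x => P.real (Ioc a x)) volume c d :=
  Monotone.intervalIntegrable fun _ _ hxy => measureReal_mono (Ioc_subset_Ioc_right hxy)

theorem intervalIntegrable_cdfDiff (P N : Measure ℝ) [IsFiniteMeasure P] [IsFiniteMeasure N]
    (a c d : ℝ) : IntervalIntegrable (cdfDiff P N a) volume c d :=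
  (intervalIntegrable_real_Ioc P a c d).sub (intervalIntegrable_real_Ioc N a c d)

theorem sub_setIntegral_Ioc_eq_sub_integral_deriv (P N : Measure ℝ) [IsFiniteMeasure P]
    [IsFiniteMeasure N] {a t : ℝ} (hat : a ≤ t) {u : ℝ → ℝ}
    (hu : AbsolutelyContinuousOnInterval u a t) :
    (∫ s in Ioc a t, u s ∂P) - ∫ s in Ioc a t, u s ∂N
      = cdfDiff P N a t * u t - ∫ s in a..t, cdfDiff P N a s * deriv u s := by
  have hmul : ∀ (Q : Measure ℝ) [IsFiniteMeasure Q],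
      IntervalIntegrable (fun s => Q.real (Ioc a s) * deriv u s) volume a t := by
    intro Q _
    have hm : Monotone fun x => Q.real (Ioc a x) :=
      fun _ _ hxy => measureReal_mono (Ioc_subset_Ioc_right hxy)
    refine ⟨?_, ?_⟩ <;>
    refine Integrable.bdd_mul (c := Q.real univ) ?_ hm.measurable.aestronglyMeasurable
      (Filter.Eventually.of_forall fun x => ?_)
    · exact hu.intervalIntegrable_deriv.1
    · rw [Real.norm_of_nonneg measureReal_nonneg]; exact measureReal_mono (subset_univ _)
    · exact hu.intervalIntegrable_deriv.2
    · rw [Real.norm_of_nonneg measureReal_nonneg]; exact measureReal_mono (subset_univ _)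
  simp only [cdfDiff, sub_mul]
  rw [setIntegral_Ioc_eq_sub_integral_deriv P hat hu,
    setIntegral_Ioc_eq_sub_integral_deriv N hat hu, intervalIntegral.integral_sub (hmul P) (hmul N)]
  ring

/-- Iterated integration by parts. -/
theorem sub_setIntegral_Ioc_eq_sum_iterInt (P N : Measure ℝ) [IsFiniteMeasure P]
    [IsFiniteMeasure N] {a t : ℝ} (hat : a ≤ t) (D : ℕ → ℝ → ℝ) (m : ℕ)
    (hac : ∀ k ≤ m, AbsolutelyContinuousOnInterval (D k) a t)
    (hD : ∀ k < m, ∀ x ∈ Ioo a t, HasDerivAt (D k) (D (k + 1) x) x) :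
    (∫ s in Ioc a t, D 0 s ∂P) - ∫ s in Ioc a t, D 0 s ∂N
      = (∑ j ∈ Finset.range (m + 1), (-1 : ℝ) ^ j * (iterInt a (cdfDiff P N a) j t * D j t))
        + (-1 : ℝ) ^ (m + 1) * ∫ s in a..t, iterInt a (cdfDiff P N a) m s * deriv (D m) s := by
  induction m with
  | zero =>
    rw [sub_setIntegral_Ioc_eq_sub_integral_deriv P N hat (hac 0 le_rfl)]
    simp [iterInt]; ring
  | succ m ih =>
    rw [ih (fun k hk => hac k (by omega)) (fun k hk => hD k (by omega)),
      Finset.sum_range_succ _ (m + 1)]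
    have h1 : ∫ s in a..t, iterInt a (cdfDiff P N a) m s * deriv (D m) s
        = ∫ s in a..t, iterInt a (cdfDiff P N a) m s * D (m + 1) s := by
      rw [intervalIntegral.integral_of_le hat, intervalIntegral.integral_of_le hat,
        integral_Ioc_eq_integral_Ioo, integral_Ioc_eq_integral_Ioo]
      exact setIntegral_congr_fun measurableSet_Ioo fun x hx => by
        simp only [(hD m (by omega) x hx).deriv]
    rw [h1, integral_mul_eq_sub_integral_primitive_mul_deriv
      (intervalIntegrable_iterInt a (intervalIntegrable_cdfDiff P N a) m a t) (hac (m + 1) le_rfl)]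
    simp only [iterInt]
    ring

theorem ConvexOn.exists_lipschitzOnWith_Icc {c d c' d' : ℝ} {g : ℝ → ℝ}
    (hg : ConvexOn ℝ (Ioo c d) g) (hc : c < c') (hd : d' < d) :
    ∃ K, LipschitzOnWith K g (Icc c' d') :=
  LocallyLipschitzOn.exists_lipschitzOnWith_of_compact isCompact_Icc
    ((hg.locallyLipschitzOn isOpen_Ioo).mono (Icc_subset_Ioo hc hd))

theorem ConvexOn.monotoneOn_sub_shift {S T : Set ℝ} {g : ℝ → ℝ} (hg : ConvexOn ℝ S g) {η : ℝ}
    (hη : 0 < η) (hT : ∀ x ∈ T, x ∈ S ∧ x + η ∈ S) :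
    MonotoneOn (fun x => (g (x + η) - g x) / η) T := by
  intro x hx y hy hxy
  rcases hxy.eq_or_lt with rfl | hxy
  · exact le_rfl
  have h1 := hg.secant_mono (hT x hx).1 (hT x hx).2 (hT y hy).2 (by linarith) (by linarith)
    (by linarith)
  have h2 := hg.secant_mono (hT y hy).2 (hT x hx).1 (hT y hy).1 (by linarith) (by linarith)
    hxy.le
  have e1 : (g (y + η) - g x) / (y + η - x) = (g x - g (y + η)) / (x - (y + η)) := by
    rw [← neg_sub (g x), ← neg_sub x, neg_div_neg_eq]
  have e2 : (g (y + η) - g y) / η = (g y - g (y + η)) / (y - (y + η)) := by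
    rw [← neg_sub (g y), show y - (y + η) = -η by ring, div_neg, neg_div]
  simp only
  rw [e2]
  refine le_trans (le_trans (le_of_eq ?_) (h1.trans e1.le)) h2
  congr 1; ring

/-- A function whose primitive is nonnegative and vanishes at the endpoints integrates
nonpositively against the (nondecreasing) derivative of a convex function. -/
theorem integral_mul_deriv_nonpos_of_convexOn {a b δ : ℝ} (hab : a < b) (hδ : 0 < δ)
    {h g : ℝ → ℝ} (hh : IntervalIntegrable h volume a b)
    (hg : ConvexOn ℝ (Ioo (a - δ) (b + δ)) g) (hb : ∫ s in a..b, h s = 0)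
    (hnn : ∀ x ∈ Ioo a b, 0 ≤ ∫ s in a..x, h s) :
    ∫ s in a..b, h s * deriv g s ≤ 0 := by
  obtain ⟨L, hL⟩ := hg.exists_lipschitzOnWith_Icc (c' := a - δ / 2) (d' := b + δ / 2)
    (by linarith) (by linarith)
  set η : ℕ → ℝ := fun j => δ / 2 / ((j : ℝ) + 1) with hηdef
  have hη0 : ∀ j, 0 < η j := fun j => by positivity
  have hη1 : ∀ j, η j ≤ δ / 2 := fun j =>
    div_le_self (by positivity) (by have : (0 : ℝ) ≤ j := j.cast_nonneg; linarith)
  have hηlim : Filter.Tendsto η Filter.atTop (nhds 0) := by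
    simpa [hηdef, div_eq_mul_inv] using
      (tendsto_one_div_add_atTop_nhds_zero_nat (𝕜 := ℝ)).const_mul (δ / 2)
  have hac : AbsolutelyContinuousOnInterval g a b := by
    refine (hL.mono ?_).absolutelyContinuousOnInterval
    rw [uIcc_of_le hab.le]; exact Icc_subset_Icc (by linarith) (by linarith)
  have hacs : ∀ j, AbsolutelyContinuousOnInterval (fun x => g (x + η j)) a b := by
    intro j
    have h1 : LipschitzOnWith L (fun x => g (x + η j)) (uIcc a b) := by
      rw [uIcc_of_le hab.le]
      refine LipschitzOnWith.of_dist_le_mul fun x hx y hy => ?_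
      have := hL.dist_le_mul (x + η j) ⟨by linarith [hx.1, hη0 j], by linarith [hx.2, hη1 j]⟩
        (y + η j) ⟨by linarith [hy.1, hη0 j], by linarith [hy.2, hη1 j]⟩
      simpa using this
    exact h1.absolutelyContinuousOnInterval
  have hacq : ∀ j, AbsolutelyContinuousOnInterval (fun x => (g (x + η j) - g x) / η j) a b := by
    intro j
    have := ((hacs j).sub hac).const_mul (η j)⁻¹
    convert! this using 2
    simp [div_eq_inv_mul]
  have hq : ∀ j, ∫ s in a..b, h s * ((g (s + η j) - g s) / η j) ≤ 0 := by
    intro j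
    rw [integral_mul_eq_sub_integral_primitive_mul_deriv hh (hacq j), hb, zero_mul, zero_sub,
      neg_nonpos, intervalIntegral.integral_of_le hab.le, integral_Ioc_eq_integral_Ioo]
    refine setIntegral_nonneg measurableSet_Ioo fun x hx => mul_nonneg (hnn x hx) ?_
    have hmono : MonotoneOn (fun x => (g (x + η j) - g x) / η j) (Ioo a b) :=
      hg.monotoneOn_sub_shift (hη0 j) fun x hx =>
        ⟨⟨by linarith [hx.1], by linarith [hx.2]⟩,
          ⟨by linarith [hx.1, hη0 j], by linarith [hx.2, hη1 j]⟩⟩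
    rw [← derivWithin_of_isOpen isOpen_Ioo hx]
    exact hmono.derivWithin_nonneg
  refine le_of_tendsto' (intervalIntegral.tendsto_integral_filter_of_dominated_convergence
    (l := Filter.atTop) (fun s => ‖h s‖ * L) ?_ ?_ (hh.norm.mul_const _) ?_) hq
  · refine Filter.Eventually.of_forall fun j => ?_
    exact (intervalIntegrable_iff.1 (hh.mul_continuousOn (hacq j).continuousOn)).aestronglyMeasurable
  · refine Filter.Eventually.of_forall fun j => Filter.Eventually.of_forall fun x hx => ?_
    rw [uIoc_of_le hab.le] at hx
    rw [norm_mul]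
    refine mul_le_mul_of_nonneg_left ?_ (norm_nonneg _)
    have := hL.dist_le_mul (x + η j) ⟨by linarith [hx.1, hη0 j], by linarith [hx.2, hη1 j]⟩
        x ⟨by linarith [hx.1], by linarith [hx.2]⟩
    rw [norm_div, Real.norm_of_nonneg (hη0 j).le, div_le_iff₀ (hη0 j)]
    rw [Real.dist_eq, Real.dist_eq, add_sub_cancel_left, abs_of_pos (hη0 j)] at this
    exact this
  · filter_upwards [hac.ae_differentiableAt] with x hx hxm
    have h1 := hasDerivAt_iff_tendsto_slope_zero.1 (hx (uIoc_subset_uIcc hxm)).hasDerivAt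
    have h2 : Filter.Tendsto η Filter.atTop (nhdsWithin 0 {0}ᶜ) :=
      tendsto_nhdsWithin_iff.2 ⟨hηlim, Filter.Eventually.of_forall fun j => (hη0 j).ne'⟩
    refine Filter.Tendsto.const_mul _ ((h1.comp h2).congr fun j => ?_)
    simp [div_eq_inv_mul]

theorem lipschitzOnWith_Icc_of_hasDerivAt {c d c' d' : ℝ} {f f' : ℝ → ℝ}
    (hf : ∀ x ∈ Ioo c d, HasDerivAt f (f' x) x) (hf' : ContinuousOn f' (Ioo c d))
    (hc : c < c') (hd : d' < d) : ∃ K, LipschitzOnWith K f (Icc c' d') := by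
  have hsub := Icc_subset_Ioo hc hd
  obtain ⟨C, hC⟩ := isCompact_Icc.exists_bound_of_continuousOn (hf'.mono hsub)
  refine ⟨C.toNNReal, (convex_Icc c' d').lipschitzOnWith_of_nnnorm_hasDerivWithin_le
    (fun x hx => (hf x (hsub hx)).hasDerivWithinAt) fun x hx => ?_⟩
  rw [← NNReal.coe_le_coe, coe_nnnorm]
  exact (hC x hx).trans (Real.le_coe_toNNReal C)

/-- The inequality for functions which are `(m+1)`-convex on a neighbourhood of `[a, b]`, presented
through the sequence `D` of their successive derivatives. -/
theorem sub_setIntegral_nonneg_of_convexOn_nhd (P N : Measure ℝ) [IsFiniteMeasure P]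
    [IsFiniteMeasure N] {a b δ : ℝ} (hab : a < b) (hδ : 0 < δ) (D : ℕ → ℝ → ℝ) (m : ℕ)
    (hD : ∀ k < m, ∀ x ∈ Ioo (a - δ) (b + δ), HasDerivAt (D k) (D (k + 1) x) x)
    (hconv : ConvexOn ℝ (Ioo (a - δ) (b + δ)) (D m))
    (hzero : ∀ k ≤ m + 1, iterInt a (cdfDiff P N a) k b = 0)
    (hsign : ∀ x ∈ Ioo a b, 0 ≤ (-1 : ℝ) ^ m * iterInt a (cdfDiff P N a) (m + 1) x) :
    0 ≤ (∫ s in Ioc a b, D 0 s ∂P) - ∫ s in Ioc a b, D 0 s ∂N := by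
  have hcont : ∀ k ≤ m, ContinuousOn (D k) (Ioo (a - δ) (b + δ)) := by
    intro k hk
    rcases hk.lt_or_eq with hk | rfl
    · exact fun x hx => (hD k hk x hx).continuousAt.continuousWithinAt
    · exact hconv.continuousOn isOpen_Ioo
  have hac : ∀ k ≤ m, AbsolutelyContinuousOnInterval (D k) a b := by
    intro k hk
    obtain ⟨K, hK⟩ : ∃ K, LipschitzOnWith K (D k) (uIcc a b) := by
      rw [uIcc_of_le hab.le]
      rcases hk.lt_or_eq with hk | rfl
      · exact lipschitzOnWith_Icc_of_hasDerivAt (hD k hk) (hcont (k + 1) hk) (by linarith)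
          (by linarith)
      · exact hconv.exists_lipschitzOnWith_Icc (by linarith) (by linarith)
    exact hK.absolutelyContinuousOnInterval
  rw [sub_setIntegral_Ioc_eq_sum_iterInt P N hab.le D m hac fun k hk x hx =>
    hD k hk x ⟨by linarith [hx.1], by linarith [hx.2]⟩, Finset.sum_eq_zero, zero_add]
  · have hint := intervalIntegrable_iterInt a (intervalIntegrable_cdfDiff P N a) m a b
    have key := integral_mul_deriv_nonpos_of_convexOn hab hδ (hint.const_mul ((-1 : ℝ) ^ m)) hconv
      (by rw [intervalIntegral.integral_const_mul]
          have := hzero (m + 1) le_rfl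
          simp only [iterInt] at this
          rw [this, mul_zero])
      (fun x hx => by rw [intervalIntegral.integral_const_mul]; exact hsign x hx)
    simp only [mul_assoc] at key
    rw [intervalIntegral.integral_const_mul] at key
    rw [pow_succ]
    linarith
  · intro j hj
    rw [hzero j (by have := Finset.mem_range.1 hj; omega)]
    ring

theorem NConvexOn.hasDerivAt_iteratedDerivWithin {m : ℕ} {a b : ℝ} {f : ℝ → ℝ}
    (hf : NConvexOn (m + 1) a b f) {k : ℕ} (hk : k < m) {x : ℝ} (hx : x ∈ Ioo a b) :
    HasDerivAt (iteratedDerivWithin k f (Ioo a b)) (iteratedDerivWithin (k + 1) f (Ioo a b) x)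
      x := by
  have h1 := hf.1.differentiableOn_iteratedDerivWithin (m := k) (by simpa using hk)
    isOpen_Ioo.uniqueDiffOn x hx
  have h2 := h1.hasDerivWithinAt
  rw [iteratedDerivWithin_succ]
  exact h2.hasDerivAt (isOpen_Ioo.mem_nhds hx)

theorem nConvexOn_of_hasDerivAt {m : ℕ} {a b : ℝ} (D : ℕ → ℝ → ℝ)
    (hD : ∀ k < m, ∀ x ∈ Ioo a b, HasDerivAt (D k) (D (k + 1) x) x)
    (hconv : ConvexOn ℝ (Ioo a b) (D m)) : NConvexOn (m + 1) a b (D 0) := by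
  have heq : ∀ k ≤ m, EqOn (iteratedDerivWithin k (D 0) (Ioo a b)) (D k) (Ioo a b) := by
    intro k
    induction k with
    | zero => intro _ x _; simp
    | succ k ih =>
      intro hk x hx
      rw [iteratedDerivWithin_succ, derivWithin_congr (ih (by omega)) (ih (by omega) hx),
        derivWithin_of_isOpen isOpen_Ioo hx, (hD k hk x hx).deriv]
  have hcont : ∀ k ≤ m, ContinuousOn (D k) (Ioo a b) := by
    intro k hk
    rcases hk.lt_or_eq with hk | rfl
    · exact fun x hx => (hD k hk x hx).continuousAt.continuousWithinAt
    · exact hconv.continuousOn isOpen_Ioo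
  refine ⟨?_, ?_⟩
  · rw [Nat.add_sub_cancel]
    refine contDiffOn_of_continuousOn_differentiableOn_deriv (fun k hk => ?_) fun k hk => ?_
    · have hk : k ≤ m := by exact_mod_cast hk
      exact (hcont k hk).congr (heq k hk)
    · have hk : k < m := by exact_mod_cast hk
      exact DifferentiableOn.congr
        (fun x hx => (hD k hk x hx).differentiableAt.differentiableWithinAt) (heq k hk.le)
  · rw [Nat.add_sub_cancel]
    exact hconv.congr (heq m le_rfl).symm

theorem tendsto_setIntegral_Ioc_contraction (P : Measure ℝ) [IsFiniteMeasure P] {a b : ℝ}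
    {f : ℝ → ℝ} (hf : ContinuousOn f (Icc a b)) {r : ℕ → ℝ} (hr : ∀ j, r j ∈ Ioo (0 : ℝ) 1)
    (hlim : Filter.Tendsto r Filter.atTop (nhds 1)) :
    Filter.Tendsto (fun j => ∫ s in Ioc a b, f ((a + b) / 2 + r j * (s - (a + b) / 2)) ∂P)
      Filter.atTop (nhds (∫ s in Ioc a b, f s ∂P)) := by
  obtain ⟨C, hC⟩ := isCompact_Icc.exists_bound_of_continuousOn hf
  have hmap : ∀ j, MapsTo (fun s => (a + b) / 2 + r j * (s - (a + b) / 2)) (Icc a b)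
      (Icc a b) := by
    intro j s hs
    obtain ⟨h0, h1⟩ := hr j
    constructor <;> nlinarith [hs.1, hs.2]
  refine tendsto_integral_of_dominated_convergence (fun _ => C) (fun j => ?_)
    (integrable_const _) (fun j => ?_) ?_
  · have h1 : ContinuousOn (fun s => f ((a + b) / 2 + r j * (s - (a + b) / 2))) (Icc a b) :=
      hf.comp (by fun_prop) (hmap j)
    exact (h1.mono Ioc_subset_Icc_self).aestronglyMeasurable measurableSet_Ioc
  · exact (ae_restrict_iff' measurableSet_Ioc).2
      (Filter.Eventually.of_forall fun s hs => hC _ (hmap j (Ioc_subset_Icc_self hs)))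
  · refine (ae_restrict_iff' measurableSet_Ioc).2 (Filter.Eventually.of_forall fun s hs => ?_)
    have hs' := Ioc_subset_Icc_self hs
    refine (hf s hs').tendsto.comp (tendsto_nhdsWithin_iff.2
      ⟨?_, Filter.Eventually.of_forall fun j => hmap j hs'⟩)
    have := (hlim.mul_const (s - (a + b) / 2)).const_add ((a + b) / 2)
    simpa using this

theorem NConvexOn.sub_setIntegral_nonneg (P N : Measure ℝ) [IsFiniteMeasure P]
    [IsFiniteMeasure N] {a b : ℝ} (hab : a < b) {m : ℕ} {f : ℝ → ℝ}
    (hf : NConvexOn (m + 1) a b f) (hfc : ContinuousOn f (Icc a b))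
    (hzero : ∀ k ≤ m + 1, iterInt a (cdfDiff P N a) k b = 0)
    (hsign : ∀ x ∈ Ioo a b, 0 ≤ (-1 : ℝ) ^ m * iterInt a (cdfDiff P N a) (m + 1) x) :
    0 ≤ (∫ s in Ioc a b, f s ∂P) - ∫ s in Ioc a b, f s ∂N := by
  set r : ℕ → ℝ := fun j => 1 - 1 / 2 * (1 / ((j : ℝ) + 1)) with hrdef
  have hr : ∀ j, r j ∈ Ioo (0 : ℝ) 1 := by
    intro j
    have h0 : 0 < 1 / ((j : ℝ) + 1) := by positivity
    have h1 : 1 / ((j : ℝ) + 1) ≤ 1 := by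
      rw [div_le_one (by positivity)]; linarith [(j.cast_nonneg : (0 : ℝ) ≤ j)]
    constructor <;> simp only [hrdef] <;> linarith
  have hlim : Filter.Tendsto r Filter.atTop (nhds 1) := by
    simpa [hrdef] using
      ((tendsto_one_div_add_atTop_nhds_zero_nat (𝕜 := ℝ)).const_mul 2⁻¹).const_sub 1
  refine ge_of_tendsto' ((tendsto_setIntegral_Ioc_contraction P hfc hr hlim).sub
    (tendsto_setIntegral_Ioc_contraction N hfc hr hlim)) fun j => ?_
  obtain ⟨h0, h1⟩ := hr j
  generalize r j = ρ at h0 h1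
  set δ := (1 - ρ) * ((b - a) / 2) with hδ
  have hδ0 : 0 < δ := mul_pos (by linarith) (by linarith)
  have hmap : ∀ x ∈ Ioo (a - δ) (b + δ), (a + b) / 2 + ρ * (x - (a + b) / 2) ∈ Ioo a b := by
    intro x hx
    have h3 : ρ * ((b - a) / 2 + δ) < (b - a) / 2 := by
      have : (b - a) / 2 - ρ * ((b - a) / 2 + δ) = (1 - ρ) ^ 2 * ((b - a) / 2) := by
        rw [hδ]; ring
      have : 0 < (1 - ρ) ^ 2 * ((b - a) / 2) := by
        have : 0 < 1 - ρ := by linarith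
        have : 0 < b - a := by linarith
        positivity
      linarith
    constructor <;> nlinarith [hx.1, hx.2]
  have key := sub_setIntegral_nonneg_of_convexOn_nhd P N hab hδ0
    (fun k x => ρ ^ k * iteratedDerivWithin k f (Ioo a b) ((a + b) / 2 + ρ * (x - (a + b) / 2)))
    m ?_ ?_ hzero hsign
  · simpa using key
  · intro k hk x hx
    have h4 : HasDerivAt (fun x => (a + b) / 2 + ρ * (x - (a + b) / 2)) ρ x := by
      simpa using (((hasDerivAt_id x).sub_const ((a + b) / 2)).const_mul ρ).const_add ((a + b) / 2)
    convert! ((hf.hasDerivAt_iteratedDerivWithin hk (hmap x hx)).comp x h4).const_mul (ρ ^ k) using 1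
    ring
  · have hc : ConvexOn ℝ (Ioo a b) (iteratedDerivWithin m f (Ioo a b)) := hf.2
    refine ⟨convex_Ioo _ _, fun x hx y hy p q hp hq hpq => ?_⟩
    have h5 := hc.2 (hmap x hx) (hmap y hy) hp hq hpq
    simp only [smul_eq_mul] at h5 ⊢
    have h6 : (a + b) / 2 + ρ * (p * x + q * y - (a + b) / 2)
        = p * ((a + b) / 2 + ρ * (x - (a + b) / 2))
          + q * ((a + b) / 2 + ρ * (y - (a + b) / 2)) := by
      linear_combination (ρ - 1) * ((a + b) / 2) * hpq
    rw [h6]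
    calc _ ≤ _ := mul_le_mul_of_nonneg_left h5 (pow_nonneg h0.le m)
      _ = _ := by ring

/-- The `j`-th derivative of `s ↦ (t - s) ^ k / k!`. -/
noncomputable def powDeriv (t : ℝ) (k j : ℕ) (s : ℝ) : ℝ :=
  if j ≤ k then (-1) ^ j * ((t - s) ^ (k - j) / (k - j).factorial) else 0

theorem hasDerivAt_powDeriv (t : ℝ) (k j : ℕ) (x : ℝ) :
    HasDerivAt (powDeriv t k j) (powDeriv t k (j + 1) x) x := by
  unfold powDeriv
  rcases lt_trichotomy j k with h | rfl | h
  · obtain ⟨i, rfl⟩ := Nat.exists_eq_add_of_lt h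
    have h1 : j + i + 1 - j = i + 1 := by omega
    have h2 : j + i + 1 - (j + 1) = i := by omega
    simp only [h.le, if_true, show j + 1 ≤ j + i + 1 by omega, h1, h2]
    have h3 := ((((hasDerivAt_id x).const_sub t).pow (i + 1)).div_const
      ((i + 1).factorial : ℝ)).const_mul ((-1 : ℝ) ^ j)
    convert! h3 using 1
    simp only [Nat.factorial_succ, id, Nat.add_sub_cancel]
    push_cast
    field_simp
    ring
  · simpa using hasDerivAt_const x ((-1 : ℝ) ^ j)
  · simpa [show ¬ j ≤ k by omega, show ¬ j + 1 ≤ k by omega] using hasDerivAt_const x (0 : ℝ)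

theorem continuous_powDeriv (t : ℝ) (k j : ℕ) : Continuous (powDeriv t k j) :=
  continuous_iff_continuousAt.2 fun x => (hasDerivAt_powDeriv t k j x).continuousAt

theorem convexOn_const_mul_powDeriv (c t : ℝ) {k m : ℕ} (hk : k ≤ m + 1) {S : Set ℝ}
    (hS : Convex ℝ S) : ConvexOn ℝ S fun s => c * powDeriv t k m s := by
  obtain ⟨p, q, hpq⟩ : ∃ p q : ℝ, ∀ s, powDeriv t k m s = p + q * s := by
    unfold powDeriv
    rcases lt_trichotomy k m with h | rfl | h
    · exact ⟨0, 0, fun s => by simp [h]⟩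
    · exact ⟨(-1) ^ k, 0, fun s => by simp⟩
    · obtain rfl : k = m + 1 := by omega
      exact ⟨(-1) ^ m * t, -(-1) ^ m, fun s => by simp; ring⟩
  simp only [hpq]
  refine ⟨hS, fun x _ y _ u v _ _ huv => le_of_eq ?_⟩
  simp only [smul_eq_mul]
  linear_combination (- c * p) * huv

theorem sub_setIntegral_powDeriv (P N : Measure ℝ) [IsFiniteMeasure P] [IsFiniteMeasure N]
    {a t : ℝ} (hat : a ≤ t) (k : ℕ) :
    (∫ s in Ioc a t, powDeriv t k 0 s ∂P) - ∫ s in Ioc a t, powDeriv t k 0 s ∂N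
      = iterInt a (cdfDiff P N a) k t := by
  have hac : ∀ j ≤ k, AbsolutelyContinuousOnInterval (powDeriv t k j) a t := by
    intro j _
    obtain ⟨K, hK⟩ := lipschitzOnWith_Icc_of_hasDerivAt (c := a - 1) (d := t + 1)
      (fun x _ => hasDerivAt_powDeriv t k j x) (continuous_powDeriv t k (j + 1)).continuousOn
      (sub_one_lt a) (lt_add_one t)
    rw [← uIcc_of_le hat] at hK
    exact hK.absolutelyContinuousOnInterval
  rw [sub_setIntegral_Ioc_eq_sum_iterInt P N hat (powDeriv t k) k hac
    fun j _ x _ => hasDerivAt_powDeriv t k j x, Finset.sum_range_succ, Finset.sum_eq_zero]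
  · have h1 : ∀ s, deriv (powDeriv t k k) s = 0 := fun s => by
      rw [(hasDerivAt_powDeriv t k k s).deriv]; simp [powDeriv]
    simp only [h1]
    simp only [powDeriv, le_refl, if_true, Nat.sub_self, pow_zero, Nat.factorial_zero, mul_zero,
      intervalIntegral.integral_zero, add_zero, zero_add, Nat.cast_one, div_one, mul_one]
    rw [mul_left_comm, ← mul_pow]; simp
  · intro j hj
    have hj := Finset.mem_range.1 hj
    simp [powDeriv, hj.le, zero_pow (show k - j ≠ 0 by omega)]

/-- For `j < n`, the `j`-th derivative of `s ↦ (t - s)₊ ^ n / n!`. -/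
noncomputable def truncPowDeriv (t : ℝ) (n j : ℕ) (s : ℝ) : ℝ :=
  (-1) ^ j * ((max (t - s) 0) ^ (n - j) / (n - j).factorial)

theorem hasDerivAt_max_zero_pow (i : ℕ) (y : ℝ) :
    HasDerivAt (fun y : ℝ => (max y 0) ^ (i + 2)) ((i + 2 : ℝ) * (max y 0) ^ (i + 1)) y := by
  rcases lt_trichotomy y 0 with h | rfl | h
  · rw [max_eq_right h.le, zero_pow (by omega), mul_zero]
    refine (hasDerivAt_const y (0 : ℝ)).congr_of_eventuallyEq ?_
    filter_upwards [gt_mem_nhds h] with z hz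
    rw [max_eq_right (le_of_lt hz), zero_pow (by omega)]
  · rw [max_self, zero_pow (by omega), mul_zero, hasDerivAt_iff_isLittleO_nhds_zero]
    have h2 : (fun h : ℝ => |h| ^ (i + 2)) =o[nhds 0] fun h : ℝ => h := by
      have : (fun h : ℝ => h ^ (i + 2)) =o[nhds 0] fun h : ℝ => h ^ 1 :=
        Asymptotics.isLittleO_pow_pow (by omega)
      simpa [abs_pow] using this.norm_left
    refine Asymptotics.IsBigO.trans_isLittleO (Asymptotics.IsBigO.of_bound 1 ?_) h2
    refine Filter.Eventually.of_forall fun h => ?_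
    simp only [zero_add, max_self, smul_zero, sub_zero, one_mul, norm_pow, Real.norm_eq_abs,
      abs_abs, zero_pow (show i + 2 ≠ 0 by omega)]
    exact pow_le_pow_left₀ (abs_nonneg _)
      (by rw [abs_of_nonneg (le_max_right _ _)]; exact max_le (le_abs_self h) (abs_nonneg h)) _
  · rw [max_eq_left h.le]
    have := hasDerivAt_pow (i + 2) y
    push_cast at this
    refine HasDerivAt.congr_of_eventuallyEq this ?_
    filter_upwards [lt_mem_nhds h] with z hz
    rw [max_eq_left (le_of_lt hz)]

theorem hasDerivAt_truncPowDeriv (t : ℝ) {n j : ℕ} (hj : j + 1 < n) (x : ℝ) :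
    HasDerivAt (truncPowDeriv t n j) (truncPowDeriv t n (j + 1) x) x := by
  unfold truncPowDeriv
  obtain ⟨i, rfl⟩ := Nat.exists_eq_add_of_lt hj
  have h1 : j + 1 + i + 1 - j = i + 2 := by omega
  have h2 : j + 1 + i + 1 - (j + 1) = i + 1 := by omega
  simp only [h1, h2]
  have h3 := (((hasDerivAt_max_zero_pow i (t - x)).comp x
    ((hasDerivAt_id x).const_sub t)).div_const ((i + 2).factorial : ℝ)).const_mul ((-1 : ℝ) ^ j)
  convert! h3 using 1
  rw [show (i + 2).factorial = (i + 2) * (i + 1).factorial from Nat.factorial_succ _]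
  push_cast
  field_simp
  ring

theorem continuous_truncPowDeriv (t : ℝ) (n j : ℕ) : Continuous (truncPowDeriv t n j) := by
  unfold truncPowDeriv; fun_prop

theorem setIntegral_truncPowDeriv (P : Measure ℝ) {a b t : ℝ} (htb : t ≤ b) {n : ℕ}
    (hn : n ≠ 0) :
    ∫ s in Ioc a b, truncPowDeriv t n 0 s ∂P = ∫ s in Ioc a t, powDeriv t n 0 s ∂P := by
  rw [setIntegral_eq_of_subset_of_forall_sdiff_eq_zero (s := Ioc a t) measurableSet_Ioc
    (Ioc_subset_Ioc_right htb)]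
  · refine setIntegral_congr_fun measurableSet_Ioc fun s hs => ?_
    simp [truncPowDeriv, powDeriv, max_eq_left (sub_nonneg.2 hs.2)]
  · intro s hs
    have : t < s := by
      by_contra h
      exact hs.2 ⟨hs.1.1, not_lt.1 h⟩
    simp [truncPowDeriv, max_eq_right (sub_nonpos.2 this.le), hn]

theorem nConvexOn_const_mul_powDeriv (c t a b : ℝ) {k m : ℕ} (hk : k ≤ m + 1) :
    NConvexOn (m + 1) a b fun s => c * powDeriv t k 0 s :=
  nConvexOn_of_hasDerivAt (fun j s => c * powDeriv t k j s)
    (fun j _ x _ => (hasDerivAt_powDeriv t k j x).const_mul c)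
    (convexOn_const_mul_powDeriv c t hk (convex_Ioo a b))

theorem nConvexOn_truncPowDeriv (t a b : ℝ) (m : ℕ) :
    NConvexOn (m + 1) a b fun s => (-1) ^ m * truncPowDeriv t (m + 1) 0 s := by
  refine nConvexOn_of_hasDerivAt (fun j s => (-1) ^ m * truncPowDeriv t (m + 1) j s)
    (fun j hj x _ => (hasDerivAt_truncPowDeriv t (by omega) x).const_mul _) ?_
  have h1 : (fun s => (-1) ^ m * truncPowDeriv t (m + 1) m s) = fun s => max (t - s) 0 := by
    ext s
    simp only [truncPowDeriv, Nat.add_sub_cancel_left, pow_one, Nat.factorial_one, Nat.cast_one,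
      div_one]
    rw [← mul_assoc, ← mul_pow]; simp
  simp only [h1]
  refine ConvexOn.sup ⟨convex_Ioo a b, fun x _ y _ u v _ _ huv => le_of_eq ?_⟩
    (convexOn_const 0 (convex_Ioo a b))
  simp only [smul_eq_mul]
  linear_combination (-t) * huv

theorem forall_nConvexOn_sub_setIntegral_nonneg_iff (P N : Measure ℝ) [IsFiniteMeasure P]
    [IsFiniteMeasure N] {a b : ℝ} (hab : a < b) (m : ℕ) :
    (∀ f : ℝ → ℝ, ContinuousOn f (Icc a b) → NConvexOn (m + 1) a b f →
        0 ≤ (∫ s in Ioc a b, f s ∂P) - ∫ s in Ioc a b, f s ∂N) ↔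
      ((∀ k ≤ m + 1, iterInt a (cdfDiff P N a) k b = 0) ∧
        ∀ x ∈ Ioo a b, 0 ≤ (-1 : ℝ) ^ m * iterInt a (cdfDiff P N a) (m + 1) x) := by
  refine ⟨fun H => ⟨fun k hk => ?_, fun x hx => ?_⟩,
    fun H f hfc hf => hf.sub_setIntegral_nonneg P N hab hfc H.1 H.2⟩
  · have h : ∀ c : ℝ, 0 ≤ c * iterInt a (cdfDiff P N a) k b := by
      intro c
      have h1 := H _ ((continuous_powDeriv b k 0).const_mul c).continuousOn
        (nConvexOn_const_mul_powDeriv c b a b hk)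
      rwa [integral_const_mul, integral_const_mul, ← mul_sub,
        sub_setIntegral_powDeriv P N hab.le k] at h1
    linarith [h 1, h (-1)]
  · have h1 := H _ ((continuous_truncPowDeriv x (m + 1) 0).const_mul _).continuousOn
      (nConvexOn_truncPowDeriv x a b m)
    rwa [integral_const_mul, integral_const_mul, ← mul_sub,
      setIntegral_truncPowDeriv P hx.2.le m.succ_ne_zero,
      setIntegral_truncPowDeriv N hx.2.le m.succ_ne_zero,
      sub_setIntegral_powDeriv P N hx.1.le (m + 1)] at h1

theorem MeasureTheory.SignedMeasure.apply_eq_real_posPart_sub_real_negPart (μ : SignedMeasure ℝ)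
    {s : Set ℝ} (hs : MeasurableSet s) :
    μ s = μ.toJordanDecomposition.posPart.real s - μ.toJordanDecomposition.negPart.real s := by
  conv_lhs => rw [← μ.toSignedMeasure_toJordanDecomposition]
  exact Measure.toSignedMeasure_sub_apply hs

theorem ConcentratedOn.sintegralOn_Icc {μ : SignedMeasure ℝ} {a b : ℝ}
    (hμ : ConcentratedOn μ (Ioc a b)) (f : ℝ → ℝ) :
    sintegralOn μ (Icc a b) f = (∫ s in Ioc a b, f s ∂μ.toJordanDecomposition.posPart)
      - ∫ s in Ioc a b, f s ∂μ.toJordanDecomposition.negPart := by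
  have h := measure_mono_null (show {a} ⊆ (Ioc a b)ᶜ by simp) hμ
  rw [SignedMeasure.totalVariation, Measure.add_apply, add_eq_zero] at h
  rw [sintegralOn, integral_Icc_eq_integral_Ioc' h.1, integral_Icc_eq_integral_Ioc' h.2]

/-- **Theorem 2.7 (reformulation of Theorem 2.1).** With `H₀ = F₂ − F₁` and
`H_k(x) = ∫_a^x H_{k−1}(t) dt`, the inequality `∫ f dμ₁ ≤ ∫ f dμ₂` holds for all
continuous `n`-convex `f : [a,b] → ℝ` iff `H_k(b) = 0` for `k = 0,1,…,n` and
`(−1)^{n+1} H_n(x) ≥ 0` for all `x ∈ (a,b)`. -/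
theorem statement9 (a b : ℝ) (hab : a < b) (n : ℕ) (hn : 1 ≤ n)
    (μ₁ μ₂ : SignedMeasure ℝ)
    (hμ₁ : ConcentratedOn μ₁ (Ioc a b)) (hμ₂ : ConcentratedOn μ₂ (Ioc a b))
    (F₁ F₂ : ℝ → ℝ)
    (hF₁ : ∀ x, F₁ x = μ₁ (Ioc a x)) (hF₂ : ∀ x, F₂ x = μ₂ (Ioc a x)) :
    (∀ f : ℝ → ℝ, ContinuousOn f (Icc a b) → NConvexOn n a b f →
        sintegralOn μ₁ (Icc a b) f ≤ sintegralOn μ₂ (Icc a b) f) ↔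
      ((∀ k ≤ n, iterInt a (fun t => F₂ t - F₁ t) k b = 0) ∧
        (∀ x ∈ Ioo a b,
          0 ≤ (-1 : ℝ) ^ (n + 1) * iterInt a (fun t => F₂ t - F₁ t) n x)) := by
  obtain ⟨m, rfl⟩ : ∃ m, n = m + 1 := ⟨n - 1, by omega⟩
  set p₁ := μ₁.toJordanDecomposition.posPart
  set n₁ := μ₁.toJordanDecomposition.negPart
  set p₂ := μ₂.toJordanDecomposition.posPart
  set n₂ := μ₂.toJordanDecomposition.negPart
  have hF : (fun t => F₂ t - F₁ t) = cdfDiff (p₂ + n₁) (p₁ + n₂) a := by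
    ext x
    rw [hF₁, hF₂, μ₁.apply_eq_real_posPart_sub_real_negPart measurableSet_Ioc,
      μ₂.apply_eq_real_posPart_sub_real_negPart measurableSet_Ioc, cdfDiff,
      measureReal_add_apply, measureReal_add_apply]
    ring
  have hsign : (-1 : ℝ) ^ (m + 1 + 1) = (-1) ^ m := by rw [pow_succ, pow_succ]; ring
  rw [hF, hsign, ← forall_nConvexOn_sub_setIntegral_nonneg_iff (p₂ + n₁) (p₁ + n₂) hab m]
  refine forall_congr' fun f => imp_congr_right fun hfc => imp_congr_right fun _ => ?_
  have hint : ∀ (Q : Measure ℝ) [IsFiniteMeasure Q], Integrable f (Q.restrict (Ioc a b)) :=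
    fun Q _ => (hfc.integrableOn_compact isCompact_Icc).mono_set Ioc_subset_Icc_self
  rw [hμ₁.sintegralOn_Icc, hμ₂.sintegralOn_Icc, Measure.restrict_add, Measure.restrict_add,
    integral_add_measure (hint p₂) (hint n₁), integral_add_measure (hint p₁) (hint n₂),
    ← sub_nonneg]
  exact iff_of_eq (congrArg (0 ≤ ·) (by ring))
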